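/- Let p ∈ ℕ₀, q ∈ ℕ and N ≠ 0. If h ∈ B^{p,q}_N satisfies Wh = 0 (as an element of B^{p,q+1}_N), then h = 0. Equivalently, the extension of W to B^{p,q}_N is injective when N ≠ 0. -/

import Mathlib

open MeasureTheory Filter Asymptotics

noncomputable section

/-- The Heisenberg group `ℍ`: `ℝ³` with the polarised group law
`(x,y,z) * (x',y',z') = (x+x', y+y', z+z'+x·y')`. -/
abbrev Heis : Type := ℝ × ℝ × ℝ

/-- The group law of the Heisenberg group. -/
def hmul (g g' : Heis) : Heis :=
  (g.1 + g'.1, g.2.1 + g'.2.1, g.2.2 + g'.2.2 + g.1 * g'.2.1)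

/-- The Lie bracket on the Lie algebra `ℝ³` of the Heisenberg group. -/
def hbracket (v w : ℝ × ℝ × ℝ) : ℝ × ℝ × ℝ :=
  (0, 0, v.1 * w.2.1 - w.1 * v.2.1)

/-- The exponential map of the Heisenberg group. -/
def hexp (v : ℝ × ℝ × ℝ) : Heis := (v.1, v.2.1, v.2.2 + v.1 * v.2.1 / 2)

/-- The inverse of the exponential map. -/
def hlog (g : Heis) : ℝ × ℝ × ℝ := (g.1, g.2.1, g.2.2 - g.1 * g.2.1 / 2)

/-- The basis element `X` of the Lie algebra. -/
def Xvec : ℝ × ℝ × ℝ := (1, 0, 0)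

/-- The basis element `Y` of the Lie algebra. -/
def Yvec : ℝ × ℝ × ℝ := (0, 1, 0)

/-- The central element `Z` of the Lie algebra. -/
def Zvec : ℝ × ℝ × ℝ := (0, 0, 1)

/-- The lattice `Γ_K = {(x, y, z/K) : x,y,z ∈ ℤ}`. -/
def GammaK (K : ℕ) : Set Heis :=
  {g | ∃ x y z : ℤ, g = ((x : ℝ), (y : ℝ), (z : ℝ) / K)}

/-- The flow generated by the left-invariant vector field associated to `U`:
`m ↦ m * exp (t U)`. -/
def hflow (U : ℝ × ℝ × ℝ) (t : ℝ) (m : Heis) : Heis := hmul m (hexp (t • U))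

/-- The action of the left-invariant vector field associated to `U` on functions. -/
def VF (U : ℝ × ℝ × ℝ) (h : Heis → ℂ) (m : Heis) : ℂ :=
  deriv (fun t : ℝ => h (hflow U t m)) 0

/-- `C^∞(M)`: smooth `Γ_K`-invariant functions on `ℍ` (functions on `M = Γ_K\ℍ`). -/
def SmoothM (K : ℕ) (h : Heis → ℂ) : Prop :=
  ContDiff ℝ (⊤ : ℕ∞) h ∧ ∀ γ ∈ GammaK K, ∀ m : Heis, h (hmul γ m) = h m

/-- `C^q(M)`: `C^q` `Γ_K`-invariant functions on `ℍ`. -/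
def CqM (K : ℕ) (q : ℕ) (g : Heis → ℂ) : Prop :=
  ContDiff ℝ q g ∧ ∀ γ ∈ GammaK K, ∀ m : Heis, g (hmul γ m) = g m

/-- `C^∞_N = {h ∈ C^∞(M) : Z h = 2πiNK·h}`. -/
def CN (K : ℕ) (N : ℤ) (h : Heis → ℂ) : Prop :=
  SmoothM K h ∧ VF Zvec h = fun m => (2 * Real.pi * Complex.I * N * K) * h m

/-- The `C^r` norm `‖f‖_{C^r} = sup_{k ≤ r} 2^{r-k} sup |f^{(k)}|` of a function on `ℝ`. -/
def CrNorm (r : ℕ) (η : ℝ → ℂ) : ℝ :=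
  ⨆ k : Fin (r + 1), (2 : ℝ) ^ (r - (k : ℕ)) * ⨆ t : ℝ, ‖iteratedDeriv (k : ℕ) η t‖

/-- The `C^r` norm of a function on `M`. -/
def MCrNorm (r : ℕ) (g : Heis → ℂ) : ℝ :=
  ⨆ k : Fin (r + 1), (2 : ℝ) ^ (r - (k : ℕ)) * ⨆ m : Heis, ‖iteratedFDeriv ℝ (k : ℕ) g m‖

/-- Test functions: `C^∞` functions with support compactly contained in `(-δ, δ)`. -/
def TestFun (δ : ℝ) (η : ℝ → ℂ) : Prop :=
  ContDiff ℝ (⊤ : ℕ∞) η ∧ HasCompactSupport η ∧ tsupport η ⊆ Set.Ioo (-δ) δ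

/-- The linear functional `ℓ_{η,m}(h) = ∫_{-δ}^{δ} η(t)·h(φ_t^W(m)) dt`. -/
def ell (Wd : ℝ × ℝ × ℝ) (δ : ℝ) (η : ℝ → ℂ) (m : Heis) (h : Heis → ℂ) : ℂ :=
  ∫ t in (-δ)..δ, η t * h (hflow Wd t m)

/-- The seminorm `|h|_{j,q}`. -/
def semiNorm (Vd Wd : ℝ × ℝ × ℝ) (δ : ℝ) (j q : ℕ) (h : Heis → ℂ) : ℝ :=
  sSup {x : ℝ | ∃ m : Heis, ∃ η : ℝ → ℂ, TestFun δ η ∧ CrNorm q η ≤ 1 ∧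
    x = ‖ell Wd δ η m ((VF Vd)^[j] h)‖}

/-- The anisotropic norm `‖h‖_{p,q}`. -/
def pqNorm (Vd Wd : ℝ × ℝ × ℝ) (δ : ℝ) (p q : ℕ) (h : Heis → ℂ) : ℝ :=
  sSup {x : ℝ | ∃ j : ℕ, j ≤ p ∧ ∃ m : Heis, ∃ η : ℝ → ℂ, TestFun δ η ∧ CrNorm q η ≤ 1 ∧
    x = ‖ell Wd δ η m ((VF Vd)^[j] h)‖}

/-- Integration over `M = Γ_K\ℍ` with respect to the probability measure `ν`
inherited from the Haar measure, computed on the fundamental domain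
`[0,1) × [0,1) × [0,1/K)` (rescaled by `K` to have total mass one). -/
def nuInt (K : ℕ) (f : Heis → ℂ) : ℂ :=
  (K : ℂ) * (∫ m in (Set.Icc (0 : ℝ) 1 ×ˢ (Set.Icc (0 : ℝ) 1 ×ˢ Set.Icc (0 : ℝ) (1 / K))), f m)

/-- The setting of the paper: a Heisenberg nilmanifold `M = Γ_K\ℍ`, a partially
hyperbolic automorphism `Φ` with `Φ_* V = λ⁻¹ V`, `Φ_* W = λ W`, `Φ_* Z = Z` for a
Heisenberg frame `{V, W, Z}`, and a fixed small `δ > 0`. -/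
structure NilSetting where
  K : ℕ
  hK : 0 < K
  lam : ℝ
  hlam : 1 < lam
  Vd : ℝ × ℝ × ℝ
  Wd : ℝ × ℝ × ℝ
  frame : hbracket Vd Wd = Zvec
  Φ : Heis → Heis
  Φbij : Function.Bijective Φ
  Φhom : ∀ g g' : Heis, Φ (hmul g g') = hmul (Φ g) (Φ g')
  Φlattice : Φ '' GammaK K = GammaK K
  ΦV : ∀ t : ℝ, Φ (hexp (t • Vd)) = hexp ((lam⁻¹ * t) • Vd)
  ΦW : ∀ t : ℝ, Φ (hexp (t • Wd)) = hexp ((lam * t) • Wd)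
  ΦZ : ∀ t : ℝ, Φ (hexp (t • Zvec)) = hexp (t • Zvec)
  δ : ℝ
  hδ : 0 < δ

namespace NilSetting

/-- The transfer operator `L : h ↦ h ∘ Φ`. -/
def L (S : NilSetting) (h : Heis → ℂ) : Heis → ℂ := fun m => h (S.Φ m)

/-- The space `C^∞_N` as a set of functions. -/
def cn (S : NilSetting) (N : ℤ) : Set (Heis → ℂ) := {h | CN S.K N h}

/-- The anisotropic norm `‖·‖_{p,q}` of the setting. -/
def nrm (S : NilSetting) (p q : ℕ) (h : Heis → ℂ) : ℝ := pqNorm S.Vd S.Wd S.δ p q h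

/-- The seminorm `|·|_{j,q}` of the setting. -/
def snrm (S : NilSetting) (j q : ℕ) (h : Heis → ℂ) : ℝ := semiNorm S.Vd S.Wd S.δ j q h

end NilSetting

/-- `(B, j)` is a realisation of the completion of `Sset` with respect to the
norm `Nrm`: `j` is linear and isometric on `Sset` and has dense image. -/
def IsCompletion (Nrm : (Heis → ℂ) → ℝ) (Sset : Set (Heis → ℂ))
    {B : Type} [NormedAddCommGroup B] [NormedSpace ℂ B] (j : (Heis → ℂ) → B) : Prop :=
  CompleteSpace B ∧
  (∀ h ∈ Sset, ∀ h' ∈ Sset, j (h + h') = j h + j h') ∧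
  (∀ (c : ℂ), ∀ h ∈ Sset, j (c • h) = c • j h) ∧
  (∀ h ∈ Sset, ‖j h‖ = Nrm h) ∧
  Dense (j '' Sset)

lemma hmul_assoc (a b c : Heis) : hmul (hmul a b) c = hmul a (hmul b c) := by
  ext <;> simp only [hmul] <;> ring

lemma hflow_zero (U m : ℝ × ℝ × ℝ) : hflow U 0 m = m := by
  ext <;> simp [hflow, hmul, hexp]

lemma hflow_hflow (U : ℝ × ℝ × ℝ) (s t : ℝ) (m : Heis) :
    hflow U s (hflow U t m) = hflow U (t + s) m := by
  ext <;> simp [hflow, hmul, hexp] <;> ring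

lemma hflow_hmul (U : ℝ × ℝ × ℝ) (t : ℝ) (g m : Heis) :
    hflow U t (hmul g m) = hmul g (hflow U t m) :=
  hmul_assoc _ _ _

lemma hflow_Zvec_comm (U : ℝ × ℝ × ℝ) (s t : ℝ) (m : Heis) :
    hflow Zvec s (hflow U t m) = hflow U t (hflow Zvec s m) := by
  ext <;> simp [hflow, hmul, hexp, Zvec]
  ring

lemma bracket_coord {V W : ℝ × ℝ × ℝ} (h : hbracket V W = Zvec) :
    V.1 * W.2.1 - W.1 * V.2.1 = 1 :=
  congrArg (fun v => v.2.2) h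

lemma hflow_comm_of_bracket {V W : ℝ × ℝ × ℝ} (h : hbracket V W = Zvec) (s t : ℝ) (m : Heis) :
    hflow W t (hflow V s m) = hflow Zvec (s * t) (hflow V s (hflow W t m)) := by
  have h1 := bracket_coord h
  ext
  · simp [hflow, hmul, hexp, Zvec]; ring
  · simp [hflow, hmul, hexp, Zvec]; ring
  · simp [hflow, hmul, hexp, Zvec]; linear_combination s * t * h1

lemma continuous_hflow (U : ℝ × ℝ × ℝ) : Continuous fun p : ℝ × Heis => hflow U p.1 p.2 := by
  unfold hflow hmul hexp
  fun_prop

/-- The left-invariant vector field associated to `U`, in coordinates. -/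
def leftField (U : ℝ × ℝ × ℝ) (m : Heis) : Heis := (U.1, U.2.1, U.2.2 + m.1 * U.2.1)

lemma hasDerivAt_hflow (U : ℝ × ℝ × ℝ) (m : Heis) (t : ℝ) :
    HasDerivAt (fun t : ℝ => hflow U t m) (leftField U (hflow U t m)) t := by
  have hid := hasDerivAt_id t
  have h1 : HasDerivAt (fun t : ℝ => m.1 + t * U.1) U.1 t := by
    simpa using (hid.mul_const U.1).const_add m.1
  have h2 : HasDerivAt (fun t : ℝ => m.2.1 + t * U.2.1) U.2.1 t := by
    simpa using (hid.mul_const U.2.1).const_add m.2.1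
  have h3 : HasDerivAt (fun t : ℝ => m.2.2 + (t * U.2.2 + t * U.1 * (t * U.2.1) / 2)
      + m.1 * (t * U.2.1)) (U.2.2 + (m.1 + t * U.1) * U.2.1) t := by
    have h := ((((hid.mul_const U.2.2).add
      (((hid.mul_const U.1).mul (hid.mul_const U.2.1)).div_const 2)).const_add m.2.2).add
      ((hid.mul_const U.2.1).const_mul m.1))
    refine h.congr_deriv ?_
    simp
    ring
  exact h1.prodMk (h2.prodMk h3)

lemma hasDerivAt_comp_hflow (U : ℝ × ℝ × ℝ) {h : Heis → ℂ} (hh : Differentiable ℝ h)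
    (m : Heis) (t : ℝ) :
    HasDerivAt (fun t : ℝ => h (hflow U t m)) (fderiv ℝ h (hflow U t m)
      (leftField U (hflow U t m))) t :=
  (hh _).hasFDerivAt.comp_hasDerivAt t (hasDerivAt_hflow U m t)

lemma VF_eq_fderiv (U : ℝ × ℝ × ℝ) {h : Heis → ℂ} (hh : Differentiable ℝ h) :
    VF U h = fun m => fderiv ℝ h m (leftField U m) := by
  funext m
  simpa [VF, hflow_zero] using (hasDerivAt_comp_hflow U hh m 0).deriv

lemma hasDerivAt_VF (U : ℝ × ℝ × ℝ) {h : Heis → ℂ} (hh : Differentiable ℝ h)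
    (m : Heis) (t : ℝ) :
    HasDerivAt (fun t : ℝ => h (hflow U t m)) (VF U h (hflow U t m)) t := by
  rw [VF_eq_fderiv U hh]
  exact hasDerivAt_comp_hflow U hh m t

lemma VF_sub (U : ℝ × ℝ × ℝ) {h h' : Heis → ℂ} (hh : Differentiable ℝ h)
    (hh' : Differentiable ℝ h') : VF U (h - h') = VF U h - VF U h' := by
  rw [VF_eq_fderiv U hh, VF_eq_fderiv U hh', VF_eq_fderiv U (hh.sub hh')]
  funext m
  simp [fderiv_sub (hh m) (hh' m)]

lemma VF_const_smul_add (U : ℝ × ℝ × ℝ) (c : ℂ) {h h' : Heis → ℂ} (hh : Differentiable ℝ h)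
    (hh' : Differentiable ℝ h') : VF U (c • h + h') = c • VF U h + VF U h' := by
  rw [VF_eq_fderiv U hh, VF_eq_fderiv U hh', VF_eq_fderiv U ((hh.const_smul c).add hh')]
  funext m
  simp [fderiv_add ((hh m).const_smul c) (hh' m), fderiv_const_smul (hh m) c]

lemma hasFDerivAt_leftField (U : ℝ × ℝ × ℝ) (m : Heis) :
    HasFDerivAt (leftField U)
      ((ContinuousLinearMap.fst ℝ ℝ (ℝ × ℝ)).smulRight ((0, 0, U.2.1) : Heis)) m := by
  have h := ((ContinuousLinearMap.fst ℝ ℝ (ℝ × ℝ)).smulRight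
    ((0, 0, U.2.1) : Heis)).hasFDerivAt (x := m) |>.const_add (U.1, U.2.1, U.2.2)
  refine h.congr_of_eventuallyEq (Eventually.of_forall fun x => ?_)
  ext <;> simp [leftField]

lemma VF_contDiff (U : ℝ × ℝ × ℝ) {h : Heis → ℂ} (hh : ContDiff ℝ (⊤ : ℕ∞) h) :
    ContDiff ℝ (⊤ : ℕ∞) (VF U h) := by
  rw [VF_eq_fderiv U (hh.differentiable (by simp))]
  refine (hh.fderiv_right (m := (⊤ : ℕ∞)) (by simp)).clm_apply ?_
  unfold leftField
  fun_prop

lemma VF_comm {V W : ℝ × ℝ × ℝ} (hVW : hbracket V W = Zvec) {f : Heis → ℂ}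
    (hf : ContDiff ℝ (⊤ : ℕ∞) f) : VF V (VF W f) = VF W (VF V f) + VF Zvec f := by
  have hd : Differentiable ℝ f := hf.differentiable (by simp)
  have hd2 : Differentiable ℝ (fderiv ℝ f) :=
    (hf.fderiv_right (m := (⊤ : ℕ∞)) (by simp)).differentiable (by simp)
  have key : ∀ U : ℝ × ℝ × ℝ, ∀ m : Heis, HasFDerivAt (VF U f) _ m := fun U m => by
    rw [VF_eq_fderiv U hd]
    exact (hd2 m).hasFDerivAt.clm_apply (hasFDerivAt_leftField U m)
  rw [VF_eq_fderiv V fun m => (key W m).differentiableAt,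
    VF_eq_fderiv W fun m => (key V m).differentiableAt, VF_eq_fderiv Zvec hd]
  funext m
  have hsymm : IsSymmSndFDerivAt ℝ f m :=
    (contDiff_infty.1 hf 2).contDiffAt.isSymmSndFDerivAt (by simp)
  have h1 := bracket_coord hVW
  have h2 : leftField Zvec m = ((leftField V m).1 • (0, 0, W.2.1) : Heis)
      - ((leftField W m).1 • (0, 0, V.2.1) : Heis) := by
    ext
    · simp [leftField, Zvec]
    · simp [leftField, Zvec]
    · simp [leftField, Zvec]
      linear_combination -h1
  simp only [Pi.add_apply, (key W m).fderiv, (key V m).fderiv, h2, map_sub]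
  simp [hsymm.eq (leftField V m) (leftField W m)]
  ring

lemma exists_GammaK_hmul_mem_Icc {K : ℕ} (hK : 0 < K) (m : Heis) :
    ∃ γ ∈ GammaK K, hmul γ m ∈ Set.Icc (0 : Heis) 1 := by
  have hK' : (0 : ℝ) < K := by exact_mod_cast hK
  have hK1 : (1 : ℝ) ≤ K := by exact_mod_cast hK
  set y : ℝ := K * (m.2.2 - ⌊m.1⌋ * m.2.1) with hy
  refine ⟨_, ⟨-⌊m.1⌋, -⌊m.2.1⌋, -⌊y⌋, rfl⟩, ?_⟩
  have h3 : hmul (((-⌊m.1⌋ : ℤ) : ℝ), ((-⌊m.2.1⌋ : ℤ) : ℝ), ((-⌊y⌋ : ℤ) : ℝ) / K) m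
      = (Int.fract m.1, Int.fract m.2.1, Int.fract y / K) := by
    ext
    · simp only [hmul, Int.fract]; push_cast; ring
    · simp only [hmul, Int.fract]; push_cast; ring
    · simp only [hmul, Int.fract]
      push_cast
      rw [hy]
      field_simp
      ring
  rw [h3]
  refine ⟨⟨Int.fract_nonneg _, Int.fract_nonneg _, div_nonneg (Int.fract_nonneg _) hK'.le⟩,
    (Int.fract_lt_one _).le, (Int.fract_lt_one _).le, ?_⟩
  exact (div_le_one hK').2 ((Int.fract_lt_one _).le.trans hK1)

lemma exists_bound_of_invariant {K : ℕ} (hK : 0 < K) {f : Heis → ℂ} (hf : Continuous f)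
    (hinv : ∀ γ ∈ GammaK K, ∀ m : Heis, f (hmul γ m) = f m) : ∃ C, ∀ m, ‖f m‖ ≤ C := by
  obtain ⟨C, hC⟩ := (isCompact_Icc (a := (0 : Heis)) (b := 1)).exists_bound_of_continuousOn
    hf.continuousOn
  refine ⟨C, fun m => ?_⟩
  obtain ⟨γ, hγ, hm⟩ := exists_GammaK_hmul_mem_Icc hK m
  rw [← hinv γ hγ m]
  exact hC _ hm

/-- `f` is equivariant under the centre with frequency `κ`. -/
def CentralEquivariant (κ : ℝ) (f : Heis → ℂ) : Prop :=
  ∀ t m, f (hflow Zvec t m) = Complex.exp (κ * t * Complex.I) * f m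

/-- Translation along `V` by a small amount `s`, followed by a long translation along `W`, picks up
a central phase; choosing the phase to be `-1` forces `c = -c`. -/
lemma eq_zero_of_invariant {K : ℕ} (hK : 0 < K) {V W : ℝ × ℝ × ℝ} (hVW : hbracket V W = Zvec)
    {κ : ℝ} (hκ : κ ≠ 0) {c : Heis → ℂ} (hc : Continuous c)
    (hinv : ∀ γ ∈ GammaK K, ∀ m : Heis, c (hmul γ m) = c m) (hZ : CentralEquivariant κ c)
    (hW : ∀ t m, c (hflow W t m) = c m) : c = 0 := by
  funext m
  choose γ hγ hmem using exists_GammaK_hmul_mem_Icc hK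
  set t : ℕ → ℝ := fun k => k + 1
  set s : ℕ → ℝ := fun k => Real.pi / κ * (1 / ((k : ℝ) + 1))
  have hs : Tendsto s atTop (nhds 0) := by
    simpa [s] using (tendsto_one_div_add_atTop_nhds_zero_nat (𝕜 := ℝ)).const_mul (Real.pi / κ)
  set a : ℕ → Heis := fun k => hmul (γ (hflow W (t k) m)) (hflow W (t k) m)
  obtain ⟨b, -, φ, hφ, hb⟩ := (isCompact_Icc (a := (0 : Heis)) (b := 1)).tendsto_subseq
    (x := a) fun k => hmem _
  have hca : ∀ k, c (a k) = c m := fun k => by rw [hinv _ (hγ _), hW]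
  have hcb : c b = c m :=
    tendsto_nhds_unique ((hc.tendsto b).comp hb)
      (tendsto_const_nhds.congr fun k => (hca (φ k)).symm)
  have hphase : ∀ k, c (hflow V (s k) m) = -c (hflow V (s k) (a k)) := fun k => by
    have hst : κ * (s k * t k) = Real.pi := by
      have : (k : ℝ) + 1 ≠ 0 := by positivity
      simp only [s, t]
      field_simp
    have hst' : (κ : ℂ) * ((s k * t k : ℝ) : ℂ) * Complex.I = Real.pi * Complex.I := by
      rw [← hst]; push_cast; ring
    rw [← hW (t k), hflow_comm_of_bracket hVW, hZ, hst', Complex.exp_pi_mul_I, hflow_hmul,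
      hinv _ (hγ _)]
    ring
  have hl : Tendsto (fun k => c (hflow V (s (φ k)) m)) atTop (nhds (c m)) := by
    have h := (hc.comp (continuous_hflow V)).tendsto (0, m)
    simp only [Function.comp_def, hflow_zero] at h
    exact h.comp ((hs.comp hφ.tendsto_atTop).prodMk_nhds tendsto_const_nhds)
  have hr : Tendsto (fun k => c (hflow V (s (φ k)) (a (φ k)))) atTop (nhds (c b)) := by
    have h := (hc.comp (continuous_hflow V)).tendsto (0, b)
    simp only [Function.comp_def, hflow_zero] at h
    exact h.comp ((hs.comp hφ.tendsto_atTop).prodMk_nhds hb)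
  have := tendsto_nhds_unique (hl.congr fun k => hphase (φ k)) hr.neg
  rw [hcb] at this
  exact self_eq_neg.1 this

lemma tendstoUniformly_zero_of_invariant {K : ℕ} (hK : 0 < K) {V W : ℝ × ℝ × ℝ}
    (hVW : hbracket V W = Zvec) {κ : ℝ} (hκ : κ ≠ 0) {F : ℕ → Heis → ℂ}
    (hc : ∀ n, Continuous (F n))
    (hinv : ∀ n, ∀ γ ∈ GammaK K, ∀ m : Heis, F n (hmul γ m) = F n m)
    (hZ : ∀ n, CentralEquivariant κ (F n))
    (hW : ∀ t m, Tendsto (fun n => F n (hflow W t m) - F n m) atTop (nhds 0))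
    (hF : UniformCauchySeqOn F atTop Set.univ) : TendstoUniformly F 0 atTop := by
  choose G hG using fun m => cauchySeq_tendsto_of_complete (hF.cauchySeq (Set.mem_univ m))
  have hu : TendstoUniformly F G atTop :=
    tendstoUniformlyOn_univ.1 (hF.tendstoUniformlyOn_of_tendsto fun m _ => hG m)
  have hG0 : G = 0 := by
    refine eq_zero_of_invariant hK hVW hκ (hu.continuous (Frequently.of_forall hc)) ?_ ?_ ?_
    · exact fun γ hγ m => tendsto_nhds_unique (hG _) ((hG m).congr fun n => (hinv n γ hγ m).symm)
    · exact fun t m => tendsto_nhds_unique (hG _)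
        (((hG m).const_mul _).congr fun n => (hZ n t m).symm)
    · exact fun t m => sub_eq_zero.1 (tendsto_nhds_unique ((hG _).sub (hG m)) (hW t m))
  rwa [hG0] at hu

/-- The frequency of the action of the centre on `C^∞_N`. -/
def centralFreq (K : ℕ) (N : ℤ) : ℝ := 2 * Real.pi * N * K

lemma centralFreq_mul_I (K : ℕ) (N : ℤ) :
    (centralFreq K N : ℂ) * Complex.I = 2 * Real.pi * Complex.I * N * K := by
  simp only [centralFreq]
  push_cast
  ring

lemma CN_iff {K : ℕ} {N : ℤ} {h : Heis → ℂ} :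
    CN K N h ↔ SmoothM K h ∧ CentralEquivariant (centralFreq K N) h := by
  have hlin : ∀ x : ℝ, HasDerivAt (fun x : ℝ => Complex.exp (centralFreq K N * x * Complex.I))
      (Complex.exp (centralFreq K N * x * Complex.I) * (centralFreq K N * Complex.I)) x := by
    intro x
    have h1 : HasDerivAt (fun x : ℝ => (centralFreq K N : ℂ) * x * Complex.I)
        (centralFreq K N * Complex.I) x := by
      simpa using ((Complex.ofRealCLM.hasDerivAt (x := x)).const_mul
        (centralFreq K N : ℂ)).mul_const Complex.I
    exact h1.cexp
  refine and_congr_right fun hs => ?_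
  have hd : Differentiable ℝ h := hs.1.differentiable (by simp)
  constructor
  · intro hz t m
    have hderiv : ∀ x : ℝ, HasDerivAt (fun x : ℝ =>
        Complex.exp (centralFreq K N * x * Complex.I) * h (hflow Zvec (t - x) m)) 0 x := by
      intro x
      have h1 := (hasDerivAt_VF Zvec hd m (t - x)).scomp x ((hasDerivAt_id x).const_sub t)
      refine ((hlin x).mul h1).congr_deriv ?_
      rw [hz]
      simp [centralFreq]
      ring
    have h2 := is_const_of_deriv_eq_zero (fun x => (hderiv x).differentiableAt)
      (fun x => (hderiv x).deriv) 0 t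
    simpa [hflow_zero] using h2
  · intro hz
    funext m
    have h1 := hasDerivAt_VF Zvec hd m 0
    have h2 := (hlin 0).mul_const (h m)
    simp only [hz _ m] at h1
    have h3 := h1.unique h2
    rw [hflow_zero] at h3
    rw [h3, centralFreq_mul_I]
    simp

lemma SmoothM.differentiable {K : ℕ} {h : Heis → ℂ} (hh : SmoothM K h) : Differentiable ℝ h :=
  hh.1.differentiable (by simp)

lemma SmoothM.VF {K : ℕ} {h : Heis → ℂ} (hh : SmoothM K h) (U : ℝ × ℝ × ℝ) :
    SmoothM K (VF U h) := by
  refine ⟨VF_contDiff U hh.1, fun γ hγ m => ?_⟩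
  simp only [_root_.VF, hflow_hmul, hh.2 γ hγ]

lemma CN.VF {K : ℕ} {N : ℤ} {h : Heis → ℂ} (hh : CN K N h) (U : ℝ × ℝ × ℝ) :
    CN K N (VF U h) := by
  rw [CN_iff] at hh ⊢
  refine ⟨hh.1.VF U, fun t m => ?_⟩
  simp only [_root_.VF, ← hflow_Zvec_comm, hh.2 t]
  exact deriv_const_mul_field _

lemma CN.iterate_VF {K : ℕ} {N : ℤ} {h : Heis → ℂ} (hh : CN K N h) (U : ℝ × ℝ × ℝ) (i : ℕ) :
    CN K N ((_root_.VF U)^[i] h) := by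
  induction i with
  | zero => exact hh
  | succ i ih => rw [Function.iterate_succ_apply']; exact ih.VF U

lemma CN.smul {K : ℕ} {N : ℤ} {h : Heis → ℂ} (hh : CN K N h) (c : ℂ) : CN K N (c • h) := by
  rw [CN_iff] at *
  refine ⟨⟨contDiff_const.smul hh.1.1, fun γ hγ m => by simp [hh.1.2 γ hγ m]⟩, fun t m => ?_⟩
  simp only [Pi.smul_apply, hh.2 t m, smul_eq_mul]
  ring

lemma CN.sub {K : ℕ} {N : ℤ} {h h' : Heis → ℂ} (hh : CN K N h) (hh' : CN K N h') :
    CN K N (h - h') := by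
  rw [CN_iff] at *
  refine ⟨⟨hh.1.1.sub hh'.1.1, fun γ hγ m => by simp [hh.1.2 γ hγ m, hh'.1.2 γ hγ m]⟩,
    fun t m => ?_⟩
  simp only [Pi.sub_apply, hh.2 t m, hh'.2 t m]
  ring

lemma iterate_VF_sub {K : ℕ} {N : ℤ} {h h' : Heis → ℂ} (hh : CN K N h) (hh' : CN K N h')
    (U : ℝ × ℝ × ℝ) (i : ℕ) : (VF U)^[i] (h - h') = (VF U)^[i] h - (VF U)^[i] h' := by
  induction i with
  | zero => rfl
  | succ i ih =>
    simp only [Function.iterate_succ_apply', ih]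
    exact VF_sub U (hh.iterate_VF U i).1.differentiable (hh'.iterate_VF U i).1.differentiable

/-- The commutation relation `V^{i+1} W = W V^{i+1} + (i+1) Z V^i` on `C^∞_N`. -/
lemma iterate_VF_comm {K : ℕ} {N : ℤ} {V W : ℝ × ℝ × ℝ} (hVW : hbracket V W = Zvec)
    {h : Heis → ℂ} (hh : CN K N h) (i : ℕ) :
    (VF V)^[i + 1] (VF W h) = VF W ((VF V)^[i + 1] h)
      + (((i + 1 : ℕ) : ℂ) * (centralFreq K N * Complex.I)) • (VF V)^[i] h := by
  have step : ∀ f, CN K N f → VF V (VF W f) = VF W (VF V f)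
      + (centralFreq K N * Complex.I) • f := fun f hf => by
    rw [VF_comm hVW hf.1.1, hf.2, centralFreq_mul_I]
    rfl
  induction i with
  | zero => simpa using step h hh
  | succ i ih =>
    rw [Function.iterate_succ_apply', ih, add_comm,
      VF_const_smul_add V _ (hh.iterate_VF V i).1.differentiable
        ((hh.iterate_VF V (i + 1)).VF W).1.differentiable,
      step _ (hh.iterate_VF V (i + 1)), ← Function.iterate_succ_apply' (VF V) i,
      ← Function.iterate_succ_apply' (VF V) (i + 1)]
    funext m
    simp
    ring

lemma TestFun.const_smul {δ : ℝ} {η : ℝ → ℂ} (hη : TestFun δ η) (c : ℂ) : TestFun δ (c • η) :=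
  ⟨contDiff_const.smul hη.1, HasCompactSupport.smul_left (f := fun _ => c) hη.2.1,
    (tsupport_smul_subset_right (fun _ => c) η).trans hη.2.2⟩

lemma CrNorm_nonneg (q : ℕ) (η : ℝ → ℂ) : 0 ≤ CrNorm q η :=
  Real.iSup_nonneg fun _ => mul_nonneg (by positivity) (Real.iSup_nonneg fun _ => norm_nonneg _)

lemma CrNorm_const_smul (q : ℕ) (c : ℂ) (η : ℝ → ℂ) : CrNorm q (c • η) = ‖c‖ * CrNorm q η := by
  simp only [CrNorm, iteratedDeriv_const_smul_field, norm_smul,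
    ← Real.mul_iSup_of_nonneg (norm_nonneg c)]
  rw [Real.mul_iSup_of_nonneg (norm_nonneg c)]
  exact congrArg _ (funext fun k => by ring)

lemma TestFun.norm_le_CrNorm {δ : ℝ} {η : ℝ → ℂ} (hη : TestFun δ η) (q : ℕ) (t : ℝ) :
    ‖η t‖ ≤ CrNorm q η := by
  obtain ⟨C, hC⟩ := hη.2.1.exists_bound_of_continuous hη.1.continuous
  have h1 : ‖η t‖ ≤ ⨆ t : ℝ, ‖iteratedDeriv ((0 : Fin (q + 1)) : ℕ) η t‖ := by
    simpa using le_ciSup (f := fun t => ‖η t‖) ⟨C, by rintro _ ⟨s, rfl⟩; exact hC s⟩ t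
  have h2 := le_ciSup (f := fun k : Fin (q + 1) => (2 : ℝ) ^ (q - (k : ℕ)) *
    ⨆ t : ℝ, ‖iteratedDeriv (k : ℕ) η t‖) (Set.finite_range _).bddAbove 0
  refine h1.trans (le_trans ?_ h2)
  exact le_mul_of_one_le_left ((norm_nonneg _).trans h1) (one_le_pow₀ (by norm_num))

lemma ell_const_smul (W : ℝ × ℝ × ℝ) (δ : ℝ) (c : ℂ) (η : ℝ → ℂ) (m : Heis) (h : Heis → ℂ) :
    ell W δ (c • η) m h = c * ell W δ η m h := by
  simp only [ell, Pi.smul_apply, smul_eq_mul, mul_assoc, intervalIntegral.integral_const_mul]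

lemma ell_smul (W : ℝ × ℝ × ℝ) (δ : ℝ) (c : ℂ) (η : ℝ → ℂ) (m : Heis) (h : Heis → ℂ) :
    ell W δ η m (c • h) = c * ell W δ η m h := by
  simp only [ell, Pi.smul_apply, smul_eq_mul, mul_left_comm _ c,
    intervalIntegral.integral_const_mul]

lemma continuous_ell_integrand (W : ℝ × ℝ × ℝ) {η : ℝ → ℂ} (hη : Continuous η) {h : Heis → ℂ}
    (hh : Continuous h) : Continuous fun p : Heis × ℝ => η p.2 * h (hflow W p.2 p.1) :=
  (hη.comp continuous_snd).mul
    (hh.comp ((continuous_hflow W).comp (continuous_snd.prodMk continuous_fst)))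

lemma continuous_ell (W : ℝ × ℝ × ℝ) (δ : ℝ) {η : ℝ → ℂ} (hη : Continuous η) {h : Heis → ℂ}
    (hh : Continuous h) : Continuous fun m => ell W δ η m h :=
  intervalIntegral.continuous_parametric_intervalIntegral_of_continuous'
    (f := fun m t => η t * h (hflow W t m)) (continuous_ell_integrand W hη hh) _ _

lemma intervalIntegrable_ell (W : ℝ × ℝ × ℝ) (a b : ℝ) {η : ℝ → ℂ} (hη : Continuous η)
    {h : Heis → ℂ} (hh : Continuous h) (m : Heis) :
    IntervalIntegrable (fun t => η t * h (hflow W t m)) volume a b :=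
  ((continuous_ell_integrand W hη hh).comp
    (continuous_const.prodMk continuous_id)).intervalIntegrable a b

lemma ell_add (W : ℝ × ℝ × ℝ) (δ : ℝ) {η : ℝ → ℂ} (hη : Continuous η) (m : Heis)
    {h h' : Heis → ℂ} (hh : Continuous h) (hh' : Continuous h') :
    ell W δ η m (h + h') = ell W δ η m h + ell W δ η m h' := by
  simp only [ell]
  rw [← intervalIntegral.integral_add (intervalIntegrable_ell W _ _ hη hh m)
    (intervalIntegrable_ell W _ _ hη hh' m)]
  simp only [Pi.add_apply, mul_add]

lemma ell_sub (W : ℝ × ℝ × ℝ) (δ : ℝ) {η : ℝ → ℂ} (hη : Continuous η) (m : Heis)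
    {h h' : Heis → ℂ} (hh : Continuous h) (hh' : Continuous h') :
    ell W δ η m (h - h') = ell W δ η m h - ell W δ η m h' := by
  simp only [ell]
  rw [← intervalIntegral.integral_sub (intervalIntegrable_ell W _ _ hη hh m)
    (intervalIntegrable_ell W _ _ hη hh' m)]
  simp only [Pi.sub_apply, mul_sub]

lemma ell_hmul {K : ℕ} (W : ℝ × ℝ × ℝ) (δ : ℝ) (η : ℝ → ℂ) {h : Heis → ℂ} (hh : SmoothM K h)
    {γ : Heis} (hγ : γ ∈ GammaK K) (m : Heis) : ell W δ η (hmul γ m) h = ell W δ η m h := by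
  simp only [ell, hflow_hmul, hh.2 γ hγ]

lemma ell_centralEquivariant (W : ℝ × ℝ × ℝ) (δ : ℝ) (η : ℝ → ℂ) {κ : ℝ} {h : Heis → ℂ}
    (hh : CentralEquivariant κ h) : CentralEquivariant κ fun m => ell W δ η m h := by
  intro t m
  simp only [ell, ← hflow_Zvec_comm, hh t, mul_left_comm (η _),
    intervalIntegral.integral_const_mul]

lemma ell_hflow_sub (W : ℝ × ℝ × ℝ) (δ : ℝ) {η : ℝ → ℂ} (hη : Continuous η) {h : Heis → ℂ}
    (hh : ContDiff ℝ (⊤ : ℕ∞) h) (t : ℝ) (m : Heis) :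
    ell W δ η (hflow W t m) h - ell W δ η m h
      = ∫ r in (0 : ℝ)..t, ell W δ η (hflow W r m) (VF W h) := by
  have hVF : Continuous (VF W h) := (VF_contDiff W hh).continuous
  have hd : Differentiable ℝ h := hh.differentiable (by simp)
  simp only [ell]
  rw [intervalIntegral_intervalIntegral_swap, ← intervalIntegral.integral_sub
    (intervalIntegrable_ell W _ _ hη hh.continuous _)
    (intervalIntegrable_ell W _ _ hη hh.continuous _)]
  · refine intervalIntegral.integral_congr fun s _ => ?_
    simp only [intervalIntegral.integral_const_mul, ← mul_sub]
    congr 1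
    have hcont : Continuous fun r => VF W h (hflow W r (hflow W s m)) :=
      hVF.comp ((continuous_hflow W).comp (continuous_id.prodMk continuous_const))
    have h1 := intervalIntegral.integral_eq_sub_of_hasDerivAt
      (fun r _ => hasDerivAt_VF W hd (hflow W s m) r) (hcont.intervalIntegrable 0 t)
    rw [hflow_zero] at h1
    simp only [hflow_hflow, add_comm s] at h1 ⊢
    exact h1.symm
  · have hcont : Continuous (Function.uncurry fun r s => η s * VF W h (hflow W s (hflow W r m))) :=
      (continuous_ell_integrand W hη hVF).comp
        ((((continuous_hflow W).comp (continuous_fst.prodMk continuous_const))).prodMk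
          continuous_snd)
    exact (hcont.continuousOn.integrableOn_compact
      (isCompact_uIcc.prod isCompact_uIcc)).mono_set
      (Set.prod_mono Set.uIoc_subset_uIcc Set.uIoc_subset_uIcc)

lemma norm_ell_hflow_sub_le (W : ℝ × ℝ × ℝ) (δ : ℝ) {η : ℝ → ℂ} (hη : Continuous η)
    {h : Heis → ℂ} (hh : ContDiff ℝ (⊤ : ℕ∞) h) {C : ℝ}
    (hC : ∀ m, ‖ell W δ η m (VF W h)‖ ≤ C) (t : ℝ) (m : Heis) :
    ‖ell W δ η (hflow W t m) h - ell W δ η m h‖ ≤ C * |t| := by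
  rw [ell_hflow_sub W δ hη hh]
  simpa using intervalIntegral.norm_integral_le_of_norm_le_const (a := 0) (b := t)
    (f := fun r => ell W δ η (hflow W r m) (VF W h)) fun r _ => hC _

lemma bddAbove_pqNorm {K : ℕ} (hK : 0 < K) {N : ℤ} (V W : ℝ × ℝ × ℝ) (δ : ℝ) (p q : ℕ)
    {h : Heis → ℂ} (hh : CN K N h) :
    BddAbove {x : ℝ | ∃ j : ℕ, j ≤ p ∧ ∃ m : Heis, ∃ η : ℝ → ℂ, TestFun δ η ∧ CrNorm q η ≤ 1 ∧
      x = ‖ell W δ η m ((VF V)^[j] h)‖} := by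
  choose C hC using fun i => exists_bound_of_invariant hK (hh.iterate_VF V i).1.1.continuous
    (hh.iterate_VF V i).1.2
  refine ⟨(∑ i ∈ Finset.range (p + 1), |C i|) * |δ - -δ|, ?_⟩
  rintro _ ⟨i, hi, m, η, hη, hq, rfl⟩
  refine intervalIntegral.norm_integral_le_of_norm_le_const fun t _ => ?_
  rw [norm_mul]
  have h1 : ‖(VF V)^[i] h (hflow W t m)‖ ≤ ∑ i ∈ Finset.range (p + 1), |C i| :=
    ((hC i _).trans (le_abs_self _)).trans (Finset.single_le_sum (f := fun i => |C i|)
      (fun _ _ => abs_nonneg _) (Finset.mem_range.2 (by omega)))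
  exact (mul_le_of_le_one_left (norm_nonneg _) ((hη.norm_le_CrNorm q t).trans hq)).trans h1

lemma norm_ell_le {K : ℕ} (hK : 0 < K) {N : ℤ} (V W : ℝ × ℝ × ℝ) (δ : ℝ) {p : ℕ} (q : ℕ)
    {η : ℝ → ℂ} (hη : TestFun δ η) {h : Heis → ℂ} (hh : CN K N h) {i : ℕ} (hi : i ≤ p)
    (m : Heis) :
    ‖ell W δ η m ((VF V)^[i] h)‖ ≤ (CrNorm q η + 1) * pqNorm V W δ p q h := by
  have hA : 0 < CrNorm q η + 1 := by linarith [CrNorm_nonneg q η]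
  set c : ℂ := ((CrNorm q η + 1 : ℝ) : ℂ)⁻¹ with hc
  have hcn : ‖c‖ = (CrNorm q η + 1)⁻¹ := by
    rw [hc, norm_inv, Complex.norm_real, Real.norm_of_nonneg hA.le]
  have hle : CrNorm q (c • η) ≤ 1 := by
    rw [CrNorm_const_smul, hcn, inv_mul_le_iff₀ hA]
    linarith
  have h1 := le_csSup (bddAbove_pqNorm hK V W δ p q hh)
    ⟨i, hi, m, c • η, hη.const_smul c, hle, rfl⟩
  rwa [ell_const_smul, norm_mul, hcn, inv_mul_le_iff₀ hA] at h1

/-- The leafwise integrals of a Cauchy sequence in `C^∞_N` whose images under `W` tend to zero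
converge uniformly to zero. -/
lemma tendstoUniformly_ell_zero {K : ℕ} (hK : 0 < K) {N : ℤ} (hN : N ≠ 0) {V W : ℝ × ℝ × ℝ}
    (hVW : hbracket V W = Zvec) (δ : ℝ) {p q q' : ℕ} {h : ℕ → Heis → ℂ} (hh : ∀ n, CN K N (h n))
    (hcauchy : ∀ ε > 0, ∃ n₀, ∀ n ≥ n₀, ∀ k ≥ n₀, pqNorm V W δ p q (h n - h k) < ε)
    (hW : Tendsto (fun n => pqNorm V W δ p q' (VF W (h n))) atTop (nhds 0))
    {η : ℝ → ℂ} (hη : TestFun δ η) {i : ℕ} (hi : i ≤ p) :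
    TendstoUniformly (fun n m => ell W δ η m ((VF V)^[i] (h n))) 0 atTop := by
  have hηc : Continuous η := hη.1.continuous
  have hκ : centralFreq K N ≠ 0 := by
    have : (K : ℝ) ≠ 0 := by exact_mod_cast hK.ne'
    simp [centralFreq, Real.pi_ne_zero, hN, this]
  have hcont : ∀ i n, Continuous ((VF V)^[i] (h n)) :=
    fun i n => ((hh n).iterate_VF V i).1.1.continuous
  have hcomm : ∀ i ≤ p, TendstoUniformly
      (fun n m => ell W δ η m ((VF V)^[i] (VF W (h n)))) 0 atTop := by
    intro i hi
    rw [Metric.tendstoUniformly_iff]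
    intro ε hε
    have h0 := hW.const_mul (CrNorm q' η + 1)
    rw [mul_zero] at h0
    filter_upwards [h0.eventually_lt_const hε] with n hn m
    simpa using (norm_ell_le hK V W δ q' hη ((hh n).VF W) hi m).trans_lt hn
  have step : ∀ i ≤ p, TendstoUniformly
      (fun n m => ell W δ η m (VF W ((VF V)^[i] (h n)))) 0 atTop →
      TendstoUniformly (fun n m => ell W δ η m ((VF V)^[i] (h n))) 0 atTop := by
    intro i hi hWi
    refine tendstoUniformly_zero_of_invariant hK hVW hκ
      (fun n => continuous_ell W δ hηc (hcont i n))
      (fun n γ hγ m => ell_hmul W δ η ((hh n).iterate_VF V i).1 hγ m)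
      (fun n => ell_centralEquivariant W δ η (CN_iff.1 ((hh n).iterate_VF V i)).2) ?_ ?_
    · intro t m
      rw [Metric.tendsto_nhds]
      intro ε hε
      have hpos : 0 < ε / (|t| + 1) := by positivity
      filter_upwards [Metric.tendstoUniformly_iff.1 hWi _ hpos] with n hn
      have hle := norm_ell_hflow_sub_le W δ hηc ((hh n).iterate_VF V i).1.1
        (C := ε / (|t| + 1)) (fun m => by simpa using (hn m).le) t m
      rw [dist_zero_right]
      refine hle.trans_lt ?_
      rw [div_mul_eq_mul_div, div_lt_iff₀ (by positivity)]
      nlinarith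
    · rw [Metric.uniformCauchySeqOn_iff]
      intro ε hε
      have hA : 0 < CrNorm q η + 1 := by linarith [CrNorm_nonneg q η]
      obtain ⟨n₀, hn₀⟩ := hcauchy (ε / (CrNorm q η + 1)) (by positivity)
      refine ⟨n₀, fun n hn k hk m _ => ?_⟩
      rw [dist_eq_norm, ← ell_sub W δ hηc m (hcont i n) (hcont i k),
        ← iterate_VF_sub (hh n) (hh k)]
      refine (norm_ell_le hK V W δ q hη ((hh n).sub (hh k)) hi m).trans_lt ?_
      have := hn₀ n hn k hk
      rwa [lt_div_iff₀ hA, mul_comm] at this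
  induction i with
  | zero => exact step 0 hi (hcomm 0 hi)
  | succ i ih =>
    refine step (i + 1) hi ?_
    have ih' := ih (by omega)
    have hc := hcomm (i + 1) hi
    rw [Metric.tendstoUniformly_iff] at *
    intro ε hε
    set c : ℂ := ((i + 1 : ℕ) : ℂ) * (centralFreq K N * Complex.I)
    have hpos : 0 < ε / 2 / (‖c‖ + 1) := by positivity
    filter_upwards [hc (ε / 2) (by positivity), ih' _ hpos] with n h1 h2 m
    have e := congrArg (ell W δ η m) (iterate_VF_comm hVW (hh n) i)
    rw [ell_add W δ hηc m ((hh n).iterate_VF V (i + 1) |>.VF W).1.1.continuous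
      ((hcont i n).const_smul c), ell_smul] at e
    have h1m := h1 m
    have h2m := h2 m
    simp only [Pi.zero_apply, dist_zero_left] at h1m h2m ⊢
    rw [eq_sub_of_add_eq e.symm]
    refine (norm_sub_le _ _).trans_lt ?_
    rw [norm_mul]
    rw [lt_div_iff₀ (by positivity)] at h2m
    nlinarith [norm_nonneg (ell W δ η m ((VF V)^[i] (h n)))]

lemma IsCompletion.map_sub {K : ℕ} {N : ℤ} {Nrm : (Heis → ℂ) → ℝ} {B : Type}
    [NormedAddCommGroup B] [NormedSpace ℂ B] {j : (Heis → ℂ) → B}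
    (hB : IsCompletion Nrm {h | CN K N h} j) {h h' : Heis → ℂ} (hh : CN K N h)
    (hh' : CN K N h') : j (h - h') = j h - j h' := by
  have e : h - h' = h + (-1 : ℂ) • h' := by
    funext m
    simp [sub_eq_add_neg]
  rw [e, hB.2.1 h hh _ (hh'.smul (-1)), hB.2.2.1 (-1) h' hh']
  simp [sub_eq_add_neg]

lemma tendsto_zero_of_ell {K : ℕ} (hK : 0 < K) {N : ℤ} (V W : ℝ × ℝ × ℝ) (δ : ℝ) (p q : ℕ)
    {h : ℕ → Heis → ℂ} (hh : ∀ n, CN K N (h n))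
    (hcauchy : ∀ ε > 0, ∃ n₀, ∀ n ≥ n₀, ∀ k ≥ n₀, pqNorm V W δ p q (h n - h k) < ε)
    (hell : ∀ η, TestFun δ η → ∀ i ≤ p, ∀ m,
      Tendsto (fun n => ell W δ η m ((VF V)^[i] (h n))) atTop (nhds 0)) :
    ∀ ε > 0, ∃ n₀, ∀ n ≥ n₀, pqNorm V W δ p q (h n) ≤ ε := by
  intro ε hε
  obtain ⟨n₀, hn₀⟩ := hcauchy ε hε
  refine ⟨n₀, fun n hn => Real.sSup_le ?_ hε.le⟩
  rintro _ ⟨i, hi, m, η, hη, hq, rfl⟩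
  have hlim : Tendsto (fun k => ‖ell W δ η m ((VF V)^[i] (h n - h k))‖) atTop
      (nhds ‖ell W δ η m ((VF V)^[i] (h n))‖) := by
    have h1 := ((hell η hη i hi m).const_sub (ell W δ η m ((VF V)^[i] (h n)))).norm
    rw [sub_zero] at h1
    refine h1.congr fun k => ?_
    rw [iterate_VF_sub (hh n) (hh k), ell_sub W δ hη.1.continuous m
      ((hh n).iterate_VF V i).1.1.continuous ((hh k).iterate_VF V i).1.1.continuous]
  refine le_of_tendsto hlim (eventually_atTop.2 ⟨n₀, fun k hk => ?_⟩)
  exact (le_csSup (bddAbove_pqNorm hK V W δ p q ((hh n).sub (hh k)))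
    ⟨i, hi, m, η, hη, hq, rfl⟩).trans (hn₀ n hn k hk).le

/-- **Lemma 2.8 (injectivity of `W`).** Let `p ∈ ℕ₀`, `q ∈ ℕ` and `N ≠ 0`.
If `h ∈ B^{p,q}_N` satisfies `Wh = 0` in `B^{p,q+1}_N` then `h = 0`; i.e. the
continuous extension of `W` to `B^{p,q}_N` is injective. -/
theorem ker_W (S : NilSetting) (N : ℤ) (hN : N ≠ 0) (p q : ℕ) (hq : 1 ≤ q)
    (B : Type) [NormedAddCommGroup B] [NormedSpace ℂ B] (j : (Heis → ℂ) → B)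
    (B' : Type) [NormedAddCommGroup B'] [NormedSpace ℂ B'] (j' : (Heis → ℂ) → B')
    (hB : IsCompletion (S.nrm p q) (S.cn N) j)
    (hB' : IsCompletion (S.nrm p (q + 1)) (S.cn N) j')
    (Wb : B →L[ℂ] B') (hWb : ∀ h ∈ S.cn N, Wb (j h) = j' (VF S.Wd h)) :
    ∀ x : B, Wb x = 0 → x = 0 := by
  intro x hx
  obtain ⟨y, hy, hyx⟩ := mem_closure_iff_seq_limit.1 (hB.2.2.2.2 x)
  choose h hh hjh using hy
  obtain rfl : (fun n => j (h n)) = y := funext hjh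
  have hcauchy : ∀ ε > 0, ∃ n₀, ∀ n ≥ n₀, ∀ k ≥ n₀,
      pqNorm S.Vd S.Wd S.δ p q (h n - h k) < ε := by
    intro ε hε
    obtain ⟨n₀, hn₀⟩ := Metric.cauchySeq_iff.1 hyx.cauchySeq ε hε
    refine ⟨n₀, fun n hn k hk => ?_⟩
    have h1 := hn₀ n hn k hk
    rwa [dist_eq_norm, ← IsCompletion.map_sub hB (hh n) (hh k),
      hB.2.2.2.1 _ (CN.sub (hh n) (hh k))] at h1
  have hW : Tendsto (fun n => pqNorm S.Vd S.Wd S.δ p (q + 1) (VF S.Wd (h n))) atTop (nhds 0) := by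
    have h1 := ((Wb.continuous.tendsto x).comp hyx).norm
    rw [hx, norm_zero] at h1
    refine h1.congr fun n => ?_
    rw [Function.comp_apply, hWb _ (hh n), hB'.2.2.2.1 _ (CN.VF (hh n) S.Wd)]
    rfl
  have hsmall := tendsto_zero_of_ell S.hK S.Vd S.Wd S.δ p q hh hcauchy fun η hη i hi m =>
    (tendstoUniformly_ell_zero S.hK hN S.frame S.δ hh hcauchy hW hη hi).tendsto_at m
  refine norm_le_zero_iff.1 (le_of_forall_pos_le_add fun ε hε => ?_)
  obtain ⟨n₀, hn₀⟩ := hsmall ε hε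
  rw [zero_add]
  refine le_of_tendsto hyx.norm (eventually_atTop.2 ⟨n₀, fun n hn => ?_⟩)
  rw [hB.2.2.2.1 _ (hh n)]
  exact hn₀ n hn
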